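/- If cycle l satisfies Ḡ^(l) ≤ (1−λ0)·U^(l), then the integral of the avenue queue length over that cycle satisfies ∫ from B^(l) to B^(l) + U^(l) of Φ1(t) dt ≥ λ0·(Ḡ^(l))² / (2(1−λ0)). -/

import Mathlib

open MeasureTheory

/-- The integral of an affine function over an interval. -/
theorem integral_const_add_mul (a b x y : ℝ) :
    ∫ t in x..y, (a + b * t) = a * (y - x) + b * (y ^ 2 - x ^ 2) / 2 := by
  rw [intervalIntegral.integral_add (Continuous.intervalIntegrable (by fun_prop) _ _)
      (Continuous.intervalIntegrable (by fun_prop) _ _),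
    intervalIntegral.integral_const, intervalIntegral.integral_const_mul, integral_id, smul_eq_mul]
  ring

/-- A function reflected at its running minimum is integrable on compact intervals. -/
theorem intervalIntegrable_of_isLUB_sub {F Phi : ℝ → ℝ} {a b : ℝ} (hF : Continuous F)
    (hab : a ≤ b)
    (hPhi : ∀ t ∈ Set.Icc a b, IsLUB {x | ∃ s, 0 ≤ s ∧ s ≤ t ∧ x = F t - F s} (Phi t)) :
    IntervalIntegrable Phi volume a b := by
  have hmono : MonotoneOn (fun t => Phi t - F t) (Set.uIcc a b) := by
    rw [Set.uIcc_of_le hab]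
    intro u hu v hv huv
    suffices Phi u ≤ Phi v - F v + F u by simp only; linarith
    refine (hPhi u hu).2 ?_
    rintro x ⟨s, hs0, hsu, rfl⟩
    have := (hPhi v hv).1 ⟨s, hs0, hsu.trans huv, rfl⟩
    linarith
  simpa using hmono.intervalIntegrable.add (hF.intervalIntegrable a b)

/-- A nonnegative function dominating a triangular profile that rises with slope `1 - c` for a time
`g` and then falls with slope `-c` until it vanishes has at least the area of that triangle. -/
theorem triangle_area_le_integral {Phi : ℝ → ℝ} {c g b U : ℝ} (hc : 0 < c) (hc' : c < 1)
    (hg : 0 < g) (hgU : g ≤ c * U) (hint : IntervalIntegrable Phi volume b (b + U))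
    (hrise : ∀ t ∈ Set.Icc b (b + g), (1 - c) * (t - b) ≤ Phi t)
    (hfall : ∀ t ∈ Set.Icc (b + g) (b + U), g - c * (t - b) ≤ Phi t)
    (hnonneg : ∀ t ∈ Set.Icc b (b + U), 0 ≤ Phi t) :
    (1 - c) * g ^ 2 / (2 * c) ≤ ∫ t in b..(b + U), Phi t := by
  have hgd : g ≤ g / c := by rw [le_div_iff₀ hc]; nlinarith
  have hdU : g / c ≤ U := by rw [div_le_iff₀ hc]; linarith
  have hsub : ∀ x y, b ≤ x → x ≤ y → y ≤ b + U → IntervalIntegrable Phi volume x y := by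
    intro x y hx hxy hy
    refine hint.mono_set ?_
    rw [Set.uIcc_of_le hxy, Set.uIcc_of_le (by linarith)]
    exact Set.Icc_subset_Icc hx hy
  have h1 := hsub b (b + g) le_rfl (by linarith) (by linarith)
  have h2 := hsub (b + g) (b + g / c) (by linarith) (by linarith) (by linarith)
  have h3 := hsub (b + g / c) (b + U) (by linarith) (by linarith) le_rfl
  rw [← intervalIntegral.integral_add_adjacent_intervals (h1.trans h2) h3,
    ← intervalIntegral.integral_add_adjacent_intervals h1 h2]
  have e1 : ∫ t in b..(b + g), (-(1 - c) * b + (1 - c) * t) ≤ ∫ t in b..(b + g), Phi t := by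
    refine intervalIntegral.integral_mono_on (by linarith)
      (Continuous.intervalIntegrable (by fun_prop) _ _) h1 fun t ht => ?_
    linarith [hrise t ht]
  have e2 : ∫ t in (b + g)..(b + g / c), (g + c * b + -c * t) ≤
      ∫ t in (b + g)..(b + g / c), Phi t := by
    refine intervalIntegral.integral_mono_on (by linarith)
      (Continuous.intervalIntegrable (by fun_prop) _ _) h2 fun t ht => ?_
    linarith [hfall t ⟨ht.1, by linarith [ht.2]⟩]
  have e3 : 0 ≤ ∫ t in (b + g / c)..(b + U), Phi t :=
    intervalIntegral.integral_nonneg (by linarith) fun t ht =>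
      hnonneg t ⟨by linarith [ht.1], ht.2⟩
  rw [integral_const_add_mul] at e1 e2
  have harea : (1 - c) * g ^ 2 / (2 * c) =
      (-(1 - c) * b * (b + g - b) + (1 - c) * ((b + g) ^ 2 - b ^ 2) / 2) +
      ((g + c * b) * (b + g / c - (b + g)) + -c * ((b + g / c) ^ 2 - (b + g) ^ 2) / 2) := by
    field_simp
    ring
  linarith

/-- If cycle `l` satisfies `Ḡ^(l) ≤ (1−λ0)·U^(l)`, then the integral of the
avenue queue length over that cycle satisfies
`∫_{B^(l)}^{B^(l)+U^(l)} Φ1(t) dt ≥ λ0·(Ḡ^(l))² / (2(1−λ0))`. -/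
theorem stmt_8 (l0 : ℝ) (hl0 : 0 < l0) (hl0' : l0 < 1)
    (Ucyc Gbar B : ℕ → ℝ)
    (hUcyc : ∀ k, 0 < Ucyc k)
    (hGbar : ∀ k, 0 < Gbar k) (hGbarU : ∀ k, Gbar k < Ucyc k)
    (hB0 : B 0 = 0) (hBsucc : ∀ k, B (k + 1) = B k + Ucyc k)
    (Gel : ℕ → ℝ → ℝ)
    (hGel : ∀ k t, Gel k t = min (max (t - B k) 0) (Gbar k))
    (Gtot : ℝ → ℝ → ℝ)
    (hGtot : ∀ s t, Gtot s t = ∑' k, (Gel k t - Gel k s))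
    (Phi : ℝ → ℝ)
    (hPhi : ∀ t, Phi t =
      sSup {x | ∃ s, 0 ≤ s ∧ s ≤ t ∧ x = Gtot s t - (1 - l0) * (t - s)})
    (l : ℕ) (hl : Gbar l ≤ (1 - l0) * Ucyc l) :
    l0 * (Gbar l) ^ 2 / (2 * (1 - l0)) ≤ ∫ t in (B l)..(B l + Ucyc l), Phi t := by
  have hBmono : Monotone B := monotone_nat_of_le_succ fun k => by
    rw [hBsucc]; linarith [hUcyc k]
  have hBl : 0 ≤ B l := hB0 ▸ hBmono (Nat.zero_le l)
  have hGel_zero : ∀ k t, t ≤ B k → Gel k t = 0 := fun k t h => by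
    rw [hGel, max_eq_right (by linarith), min_eq_left (hGbar k).le]
  have hGel_full : ∀ k t, B k + Gbar k ≤ t → Gel k t = Gbar k := fun k t h => by
    rw [hGel, min_eq_right (le_max_of_le_left (by linarith))]
  set F : ℝ → ℝ := fun t => ∑ k ∈ Finset.range (l + 1), Gel k t - (1 - l0) * t with hF
  have hGel_cont : ∀ k, Continuous (Gel k) := fun k => by
    rw [funext (hGel k)]; fun_prop
  have hFcont : Continuous F := by fun_prop
  have hnet : ∀ t ≤ B l + Ucyc l, ∀ s ≤ t, Gtot s t - (1 - l0) * (t - s) = F t - F s := by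
    intro t ht s hst
    rw [hGtot, tsum_eq_sum (s := Finset.range (l + 1)), Finset.sum_sub_distrib]
    · simp only [hF]; ring
    · intro k hk
      have hk' : t ≤ B k := by
        rw [← hBsucc] at ht
        exact ht.trans (hBmono (by simpa using hk))
      rw [hGel_zero k t hk', hGel_zero k s (hst.trans hk'), sub_self]
  have hlub : ∀ t ∈ Set.Icc (B l) (B l + Ucyc l),
      IsLUB {x | ∃ s, 0 ≤ s ∧ s ≤ t ∧ x = F t - F s} (Phi t) := by
    intro t ht
    have hset : {x | ∃ s, 0 ≤ s ∧ s ≤ t ∧ x = Gtot s t - (1 - l0) * (t - s)} =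
        (fun s => F t - F s) '' Set.Icc 0 t := by
      ext x
      constructor
      · rintro ⟨s, h0, h1, rfl⟩
        exact ⟨s, ⟨h0, h1⟩, (hnet t ht.2 s h1).symm⟩
      · rintro ⟨s, ⟨h0, h1⟩, rfl⟩
        exact ⟨s, h0, h1, (hnet t ht.2 s h1).symm⟩
    have hset' : {x | ∃ s, 0 ≤ s ∧ s ≤ t ∧ x = F t - F s} =
        (fun s => F t - F s) '' Set.Icc 0 t := by
      ext x
      simp [and_assoc, eq_comm]
    rw [hPhi, hset, hset']
    refine isLUB_csSup ((Set.nonempty_Icc.2 (hBl.trans ht.1)).image _) ?_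
    exact (isCompact_Icc.image (by fun_prop)).bddAbove
  have hF_sub : ∀ t, B l ≤ t → F t - F (B l) = Gel l t - (1 - l0) * (t - B l) := by
    intro t ht
    have hsum : ∑ k ∈ Finset.range l, Gel k t = ∑ k ∈ Finset.range l, Gel k (B l) := by
      refine Finset.sum_congr rfl fun k hk => ?_
      have hk' : B k + Gbar k ≤ B l := by
        have := hBmono (Nat.succ_le_of_lt (Finset.mem_range.1 hk))
        rw [Nat.succ_eq_add_one, hBsucc] at this
        linarith [hGbarU k]
      rw [hGel_full k t (hk'.trans ht), hGel_full k (B l) hk']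
    simp only [hF, Finset.sum_range_succ, hsum, hGel_zero l (B l) le_rfl]
    ring
  have hlow : ∀ t ∈ Set.Icc (B l) (B l + Ucyc l), Gel l t - (1 - l0) * (t - B l) ≤ Phi t :=
    fun t ht => (hlub t ht).1 ⟨B l, hBl, ht.1, (hF_sub t ht.1).symm⟩
  have key := triangle_area_le_integral (Phi := Phi) (b := B l) (by linarith : 0 < 1 - l0)
    (by linarith) (hGbar l) hl
    (intervalIntegrable_of_isLUB_sub hFcont (by linarith [hUcyc l]) hlub)
    (fun t ht => by
      have := hlow t ⟨ht.1, by linarith [ht.2, hGbarU l]⟩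
      rw [hGel, max_eq_left (by linarith [ht.1]), min_eq_left (by linarith [ht.2])] at this
      linarith)
    (fun t ht => by
      have := hlow t ⟨by linarith [ht.1, hGbar l], ht.2⟩
      rwa [hGel_full l t ht.1] at this)
    (fun t ht => (hlub t ht).1 ⟨t, hBl.trans ht.1, le_rfl, (sub_self _).symm⟩)
  rwa [sub_sub_cancel] at key
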